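/- arXiv:2003.05888 — 2 statements merged into one kernel-verified Lean document; each statement's English description precedes it below -/
import Mathlib

section
/- Let A, P, P′, L, Λ be real q×q matrices, B a real q×r matrix, and τ ≠ 0 a real scalar, with P and L symmetric, such that AᵀP′ + P′A = (1/τ²)(ΛᵀP + PΛ) and AL + LAᵀ = −BBᵀ. Then Tr(BᵀP′B) = −(2/τ²) Tr(ΛᵀPL). (This is the formula J′(τ_o) = −(2/τ_o²)Tr(ΛᵀPL) of Theorem 1, since the derivative of the closed-loop H₂-norm J = Tr(BᵀPB) with respect to τ_o equals Tr(BᵀP′(τ_o)B), where P′(τ_o) solves the displayed differential Lyapunov equation.) -/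
open Matrix

/-- Duality between a Lyapunov equation for `X` and its adjoint equation for `L`. -/
theorem trace_mul_lyapunov {n R : Type*} [Fintype n] [CommRing R] (A X L : Matrix n n R) :
    (X * (A * L + L * Aᵀ)).trace = ((Aᵀ * X + X * A) * L).trace := by
  rw [mul_add, add_mul, trace_add, trace_add, ← mul_assoc, ← mul_assoc, trace_mul_cycle X L Aᵀ,
    add_comm]

theorem trace_mul_mul_of_isSymm {n R : Type*} [Fintype n] [CommRing R] {P L : Matrix n n R}
    (hP : P.IsSymm) (hL : L.IsSymm) (M : Matrix n n R) :
    (P * M * L).trace = (Mᵀ * P * L).trace := by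
  rw [← trace_transpose, transpose_mul, transpose_mul, hP.eq, hL.eq, trace_mul_comm]

/-- the formula `J′(τ_o) = −(2/τ_o²) Tr(ΛᵀPL)` of Theorem 1. -/
theorem h2_gradient_in_total_delay
    (q r : ℕ) (A P P' L Λ : Matrix (Fin q) (Fin q) ℝ) (B : Matrix (Fin q) (Fin r) ℝ)
    (τ : ℝ) (hτ : τ ≠ 0) (hP : P.IsSymm) (hL : L.IsSymm)
    (h1 : Aᵀ * P' + P' * A = (1 / τ ^ 2) • (Λᵀ * P + P * Λ))
    (h2 : A * L + L * Aᵀ = -(B * Bᵀ)) :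
    (Bᵀ * P' * B).trace = -(2 / τ ^ 2) * (Λᵀ * P * L).trace := by
  have h := trace_mul_lyapunov A P' L
  rw [h1, h2, mul_neg, trace_neg, smul_mul_assoc, trace_smul, add_mul, trace_add,
    trace_mul_mul_of_isSymm hP hL, smul_eq_mul, ← Matrix.mul_assoc, trace_mul_cycle P' B Bᵀ] at h
  linear_combination -h
end

section
/- Let A, P′, L be real q×q matrices with L symmetric, B a real q×r matrix, N_d and N_o real q×n matrices, G a real m×q matrix, E a real m×n matrix, and 𝓘_d, 𝓘_o real m×n matrices. Define Z_d = N_d (E∘𝓘_d)ᵀ G and Z_o = N_o (E∘𝓘_o)ᵀ G, and suppose AᵀP′ + P′A = −(Z_d + Z_dᵀ + Z_o + Z_oᵀ) and AL + LAᵀ = −BBᵀ. Then Tr(BᵀP′B) = Tr(Eᵀ · 2((G L N_d)∘𝓘_d + (G L N_o)∘𝓘_o)). (This establishes the gradient formula ∇J(K) = 2((G L N_d)∘𝓘_d + (G L N_o)∘𝓘_o) of Theorem 1, since the directional derivative of J in direction E = dK equals Tr(BᵀP′(K)B) with P′(K) solving the displayed Lyapunov equation.) -/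
open Matrix

/-- Hadamard multiplication by a fixed matrix is self-adjoint for the trace pairing. -/
theorem trace_transpose_hadamard_mul {m n R : Type*} [Fintype m] [Fintype n] [CommSemiring R]
    (E M X : Matrix m n R) :
    ((Matrix.hadamard E M)ᵀ * X).trace = (Eᵀ * Matrix.hadamard X M).trace := by
  simp only [trace, diag, mul_apply, transpose_apply, hadamard_apply]
  exact Finset.sum_congr rfl fun _ _ => Finset.sum_congr rfl fun _ _ => by ring

theorem trace_transpose_mul_of_isSymm {n R : Type*} [Fintype n] [CommSemiring R]
    (Z : Matrix n n R) {L : Matrix n n R} (hL : L.IsSymm) : (Zᵀ * L).trace = (Z * L).trace := by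
  rw [← trace_transpose, transpose_mul, transpose_transpose, hL.eq, trace_mul_comm]

theorem trace_mul_transpose_hadamard_mul {m n q R : Type*} [Fintype m] [Fintype n] [Fintype q]
    [CommSemiring R] (N : Matrix q n R) (E M : Matrix m n R) (G : Matrix m q R)
    (L : Matrix q q R) :
    (N * (Matrix.hadamard E M)ᵀ * G * L).trace =
      (Eᵀ * Matrix.hadamard (G * L * N) M).trace := by
  rw [← trace_transpose_hadamard_mul, Matrix.mul_assoc, Matrix.mul_assoc, trace_mul_comm,
    Matrix.mul_assoc]

/-- The two Lyapunov equations are adjoint to each other under the trace pairing. -/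
theorem trace_lyapunov_duality {n R : Type*} [Fintype n] [CommSemiring R]
    (A P L : Matrix n n R) :
    (P * (A * L + L * Aᵀ)).trace = ((Aᵀ * P + P * A) * L).trace := by
  rw [Matrix.mul_add, Matrix.add_mul, trace_add, trace_add, add_comm, ← Matrix.mul_assoc P L,
    trace_mul_comm (P * L), ← Matrix.mul_assoc, ← Matrix.mul_assoc]

/-- the gradient formula `∇J(K) = 2((G L N_d)∘𝓘_d + (G L N_o)∘𝓘_o)`
of Theorem 1, as a trace identity for the directional derivative in direction `E`. -/
theorem h2_gradient_in_gain
    (q r n m : ℕ) (A P' L : Matrix (Fin q) (Fin q) ℝ) (hL : L.IsSymm)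
    (B : Matrix (Fin q) (Fin r) ℝ)
    (Nd No : Matrix (Fin q) (Fin n) ℝ)
    (G : Matrix (Fin m) (Fin q) ℝ)
    (E Id Io : Matrix (Fin m) (Fin n) ℝ)
    (Zd Zo : Matrix (Fin q) (Fin q) ℝ)
    (hZd : Zd = Nd * (Matrix.hadamard E Id)ᵀ * G)
    (hZo : Zo = No * (Matrix.hadamard E Io)ᵀ * G)
    (h1 : Aᵀ * P' + P' * A = -(Zd + Zdᵀ + Zo + Zoᵀ))
    (h2 : A * L + L * Aᵀ = -(B * Bᵀ)) :
    (Bᵀ * P' * B).trace =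
      (Eᵀ * ((2 : ℝ) •
        (Matrix.hadamard (G * L * Nd) Id + Matrix.hadamard (G * L * No) Io))).trace := by
  have hBB : B * Bᵀ = -(A * L + L * Aᵀ) := by rw [h2, neg_neg]
  rw [trace_mul_comm, ← Matrix.mul_assoc, trace_mul_comm, hBB, Matrix.mul_neg, trace_neg,
    trace_lyapunov_duality, h1, Matrix.neg_mul, trace_neg, neg_neg]
  simp only [Matrix.add_mul, Matrix.mul_add, Matrix.mul_smul, trace_add, trace_smul,
    trace_transpose_mul_of_isSymm _ hL, smul_eq_mul]
  rw [hZd, hZo, trace_mul_transpose_hadamard_mul, trace_mul_transpose_hadamard_mul]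
  ring
end
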